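/- Fix γ > 0, μ_1, μ_2 ∈ ℝ, and σ > 0. Then the density power divergence between the N(μ_1,σ²) and N(μ_2,σ²) densities satisfies d_γ(f_{μ_1,σ}, f_{μ_2,σ}) = [√(1+γ)/(γ (√(2π) σ)^γ)] · [ 1 − exp( −(γ/(2(γ+1))) ((μ_1−μ_2)/σ)² ) ]. In particular d_γ(f_{μ_1,σ}, f_{μ_2,σ}) ≥ 0, with equality if and only if μ_1 = μ_2. -/

import Mathlib

open Real MeasureTheory

noncomputable section

/-- The `N(μ,σ²)` density. -/
def normalPDF (μ σ x : ℝ) : ℝ :=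
  (Real.sqrt (2 * π * σ ^ 2))⁻¹ * Real.exp (-(x - μ) ^ 2 / (2 * σ ^ 2))

/-- The density power divergence of order `γ > 0` between densities `g` and `f` on `ℝ`. -/
def dpd (γ : ℝ) (g f : ℝ → ℝ) : ℝ :=
  ∫ t : ℝ, (f t ^ (1 + γ) - (1 + 1 / γ) * f t ^ γ * g t + (1 / γ) * g t ^ (1 + γ))

lemma aux_rpow (μ σ γ x : ℝ) :
    normalPDF μ σ x ^ γ = ((Real.sqrt (2 * π * σ ^ 2))⁻¹) ^ γ *
      Real.exp (γ * (-(x - μ) ^ 2 / (2 * σ ^ 2))) := by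
  unfold normalPDF
  rw [Real.mul_rpow (by positivity) (Real.exp_pos _).le, ← Real.exp_mul]
  congr 2
  ring

lemma aux_int (b m : ℝ) (hb : 0 < b) :
    Integrable (fun t : ℝ => Real.exp (-b * (t - m) ^ 2)) :=
  (integrable_exp_neg_mul_sq hb).comp_sub_right m

lemma aux_val (b m : ℝ) : ∫ t : ℝ, Real.exp (-b * (t - m) ^ 2) = Real.sqrt (π / b) := by
  rw [integral_sub_right_eq_self (fun t : ℝ => Real.exp (-b * t ^ 2)) m, integral_gaussian]

lemma aux_closed (γ : ℝ) (hγ : 0 < γ) (μ₁ μ₂ σ : ℝ) (hσ : 0 < σ) :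
    dpd γ (normalPDF μ₁ σ) (normalPDF μ₂ σ) =
      Real.sqrt (1 + γ) / (γ * (Real.sqrt (2 * π) * σ) ^ γ) *
        (1 - Real.exp (-(γ / (2 * (γ + 1))) * ((μ₁ - μ₂) / σ) ^ 2)) := by
  have hK : Real.sqrt (2 * π * σ ^ 2) = Real.sqrt (2 * π) * σ := by
    rw [Real.sqrt_mul (by positivity), Real.sqrt_sq hσ.le]
  set E := Real.exp (-(γ / (2 * (γ + 1))) * ((μ₁ - μ₂) / σ) ^ 2) with hE
  set b := (1 + γ) / (2 * σ ^ 2) with hb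
  have hb0 : 0 < b := by positivity
  set m := (γ * μ₂ + μ₁) / (1 + γ) with hm
  have hc : 0 < (Real.sqrt (2 * π * σ ^ 2))⁻¹ := by positivity
  set A := ((Real.sqrt (2 * π * σ ^ 2))⁻¹) ^ (1 + γ) with hA
  have hpow : ∀ μ t : ℝ, normalPDF μ σ t ^ (1 + γ) = A * Real.exp (-b * (t - μ) ^ 2) := by
    intro μ t
    rw [aux_rpow]
    congr 2
    rw [hb]; ring
  have hcross : ∀ t : ℝ, normalPDF μ₂ σ t ^ γ * normalPDF μ₁ σ t =
      A * E * Real.exp (-b * (t - m) ^ 2) := by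
    intro t
    rw [aux_rpow, hA, add_comm 1 γ, Real.rpow_add hc, Real.rpow_one, hE, mul_assoc _ (Real.exp _)
      (Real.exp _), ← Real.exp_add]
    unfold normalPDF
    rw [mul_mul_mul_comm, ← Real.exp_add]
    congr 2
    rw [hb, hm]
    have : 1 + γ ≠ 0 := by positivity
    have : γ + 1 ≠ 0 := by positivity
    field_simp
    ring
  have h1 : dpd γ (normalPDF μ₁ σ) (normalPDF μ₂ σ) =
      ∫ t : ℝ, (A * Real.exp (-b * (t - μ₂) ^ 2)
        - (1 + 1 / γ) * (A * E) * Real.exp (-b * (t - m) ^ 2)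
        + (1 / γ * A) * Real.exp (-b * (t - μ₁) ^ 2)) := by
    unfold dpd
    congr 1
    funext t
    rw [hpow, hpow, mul_assoc (1 + 1 / γ), hcross]
    ring
  have i1 := (aux_int b μ₂ hb0).const_mul A
  have i2 := (aux_int b m hb0).const_mul ((1 + 1 / γ) * (A * E))
  have i3 := (aux_int b μ₁ hb0).const_mul (1 / γ * A)
  rw [h1, integral_add (by exact i1.sub i2) i3, integral_sub i1 i2]
  simp only [integral_const_mul, aux_val]
  have hs : Real.sqrt (π / b) = Real.sqrt (2 * π) * σ / Real.sqrt (1 + γ) := by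
    rw [← hK, ← Real.sqrt_div (by positivity)]
    congr 1
    rw [hb]; field_simp
  have hK0 : 0 < Real.sqrt (2 * π) * σ := by positivity
  rw [hs, hA, hK, Real.inv_rpow hK0.le, Real.rpow_add hK0, Real.rpow_one]
  have hp : 0 < (Real.sqrt (2 * π) * σ) ^ γ := by positivity
  generalize (Real.sqrt (2 * π) * σ) ^ γ = P at hp
  generalize Real.sqrt (2 * π) * σ = K at hK0
  have hq : Real.sqrt (1 + γ) ^ 2 = 1 + γ := Real.sq_sqrt (by positivity)
  have hq0 : 0 < Real.sqrt (1 + γ) := by positivity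
  generalize Real.sqrt (1 + γ) = q at hq hq0
  field_simp
  rw [hq]
  ring

/-- **Equal-variance DPD between normal densities**: closed form, nonnegativity, and the
characterization of the equality case. -/
theorem dpd_equal_variance_normals
    (γ : ℝ) (hγ : 0 < γ) (μ₁ μ₂ σ : ℝ) (hσ : 0 < σ) :
    dpd γ (normalPDF μ₁ σ) (normalPDF μ₂ σ) =
      Real.sqrt (1 + γ) / (γ * (Real.sqrt (2 * π) * σ) ^ γ) *
        (1 - Real.exp (-(γ / (2 * (γ + 1))) * ((μ₁ - μ₂) / σ) ^ 2)) ∧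
    0 ≤ dpd γ (normalPDF μ₁ σ) (normalPDF μ₂ σ) ∧
    (dpd γ (normalPDF μ₁ σ) (normalPDF μ₂ σ) = 0 ↔ μ₁ = μ₂) := by
  have h := aux_closed γ hγ μ₁ μ₂ σ hσ
  have hC : 0 < Real.sqrt (1 + γ) / (γ * (Real.sqrt (2 * π) * σ) ^ γ) := by positivity
  refine ⟨h, ?_, ?_⟩
  · rw [h]
    refine mul_nonneg hC.le ?_
    rw [sub_nonneg, Real.exp_le_one_iff, neg_mul, neg_nonpos]
    positivity
  · rw [h, mul_eq_zero, or_iff_right hC.ne', sub_eq_zero, eq_comm, Real.exp_eq_one_iff]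
    have h2 : -(γ / (2 * (γ + 1))) ≠ 0 := by
      rw [neg_ne_zero]; positivity
    rw [mul_eq_zero, or_iff_right h2, sq_eq_zero_iff, div_eq_zero_iff, or_iff_left hσ.ne',
      sub_eq_zero]

end
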